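/- arXiv:2210.14811 — 5 statements merged into one kernel-verified Lean document; each statement's English description precedes it below -/
import Mathlib

section
/- Let J > 0 and α be real numbers with 0 < J·α < π/2, and let (E₁,E₂) ∈ [−1,1]×[−1,1] satisfy (1/2)(√(1+E₁)·√(1+E₂) + √(1−E₁)·√(1−E₂)) ≥ cos(J·α). Then there exist d ∈ ℕ, reals j : Fin d → ℝ with |j_k| ≤ J for all k, a unit vector φ ∈ ℂ^d, and a complex d×d matrix M with both M and I−M positive semidefinite, such that 2·⟨φ, M φ⟩ − 1 = E₁ and 2·⟨U φ, M (U φ)⟩ − 1 = E₂, where U is the diagonal matrix with entries U_{kk} = exp(i·j_k·α). (Every correlation satisfying the overlap inequality is realised by a quantum model of spin at most J.) -/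
open Real Matrix
open scoped ComplexOrder

/-- The two-level state with opposite phases `x` and `-x` on an equally weighted superposition. -/
noncomputable def phaseVector (x : ℝ) : Fin 2 → ℂ :=
  ![((√2)⁻¹ : ℝ) * Complex.exp (Complex.I * x), ((√2)⁻¹ : ℝ) * Complex.exp (Complex.I * (-x))]

/-- The projection onto the span of `(1, 1)`. -/
noncomputable def plusProjection : Matrix (Fin 2) (Fin 2) ℂ :=
  (1 / 2 : ℂ) • vecMulVec ![1, 1] (star ![1, 1])

lemma inv_sqrt_two_mul_self : (((√2)⁻¹ : ℝ) : ℂ) * ((√2)⁻¹ : ℝ) = 1 / 2 := by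
  rw [← Complex.ofReal_mul, ← mul_inv, Real.mul_self_sqrt (by norm_num)]
  norm_num

lemma plusProjection_posSemidef : plusProjection.PosSemidef :=
  (posSemidef_vecMulVec_self_star _).smul (by norm_num [Complex.le_def])

lemma one_sub_plusProjection_posSemidef : (1 - plusProjection).PosSemidef := by
  have h : 1 - plusProjection = (1 / 2 : ℂ) • vecMulVec ![1, -1] (star ![1, -1]) := by
    ext i k
    fin_cases i <;> fin_cases k <;>
      norm_num [plusProjection, Matrix.smul_apply, vecMulVec_apply, -cons_vecMulVec]
  rw [h]
  exact (posSemidef_vecMulVec_self_star _).smul (by norm_num [Complex.le_def])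

lemma exp_I_mul_mul_exp_I_mul_neg (x : ℝ) :
    Complex.exp (Complex.I * x) * Complex.exp (Complex.I * (-x)) = 1 := by
  rw [← Complex.exp_add]
  simp

lemma star_phaseVector (x : ℝ) : star (phaseVector x) = phaseVector (-x) := by
  ext i
  fin_cases i <;> simp [phaseVector, ← Complex.exp_conj]

lemma phaseVector_norm (x : ℝ) : star (phaseVector x) ⬝ᵥ phaseVector x = 1 := by
  rw [star_phaseVector]
  simp only [phaseVector, dotProduct, Fin.sum_univ_two, cons_val_zero, cons_val_one,
    Complex.ofReal_neg, neg_neg]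
  linear_combination (2 * Complex.exp (Complex.I * x) * Complex.exp (Complex.I * (-x))) *
    inv_sqrt_two_mul_self + exp_I_mul_mul_exp_I_mul_neg x

lemma phaseVector_expectation (x : ℝ) :
    2 * (star (phaseVector x) ⬝ᵥ plusProjection.mulVec (phaseVector x)) - 1
      = (Real.cos (2 * x) : ℂ) := by
  have hexp := exp_I_mul_mul_exp_I_mul_neg x
  have hcos : (Real.cos (2 * x) : ℂ) = (Complex.exp (Complex.I * x) ^ 2
      + Complex.exp (Complex.I * (-x)) ^ 2) / 2 := by
    rw [Complex.ofReal_cos, Complex.cos, ← Complex.exp_nat_mul, ← Complex.exp_nat_mul]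
    push_cast
    ring_nf
  rw [star_phaseVector, hcos]
  simp only [phaseVector, plusProjection, dotProduct, mulVec, Matrix.smul_apply, vecMulVec_apply,
    Fin.sum_univ_two, cons_val_zero, cons_val_one, Complex.ofReal_neg, neg_neg, Pi.star_apply,
    star_one, smul_eq_mul]
  linear_combination ((Complex.exp (Complex.I * x) + Complex.exp (Complex.I * (-x))) ^ 2) *
    inv_sqrt_two_mul_self + hexp

lemma diagonal_mulVec_phaseVector (s α x : ℝ) :
    (Matrix.diagonal fun k => Complex.exp (Complex.I * ((![s, -s] : Fin 2 → ℝ) k * α))).mulVec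
      (phaseVector x) = phaseVector (x + s * α) := by
  ext i
  rw [mulVec_diagonal]
  fin_cases i
  all_goals
    simp only [phaseVector, Fin.zero_eta, Fin.mk_one, cons_val_zero, cons_val_one]
    rw [mul_left_comm, ← Complex.exp_add]
    push_cast
    ring_nf

lemma sqrt_one_add_eq {E : ℝ} (h : E ∈ Set.Icc (-1 : ℝ) 1) :
    √(1 + E) = √2 * Real.cos (Real.arccos E / 2) := by
  rw [Real.cos_half (by linarith [Real.arccos_nonneg E, Real.pi_pos]) (Real.arccos_le_pi E),
    Real.cos_arccos h.1 h.2, ← Real.sqrt_mul (by norm_num)]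
  ring_nf

lemma sqrt_one_sub_eq {E : ℝ} (h : E ∈ Set.Icc (-1 : ℝ) 1) :
    √(1 - E) = √2 * Real.sin (Real.arccos E / 2) := by
  rw [Real.sin_half_eq_sqrt (Real.arccos_nonneg E)
    (by linarith [Real.arccos_le_pi E, Real.pi_pos]),
    Real.cos_arccos h.1 h.2, ← Real.sqrt_mul (by norm_num)]
  ring_nf

/-- The overlap of two correlations is the cosine of the difference of their half angles. -/
lemma overlap_eq_cos {E₁ E₂ : ℝ} (hE₁ : E₁ ∈ Set.Icc (-1 : ℝ) 1)
    (hE₂ : E₂ ∈ Set.Icc (-1 : ℝ) 1) :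
    (1 / 2) * (√(1 + E₁) * √(1 + E₂) + √(1 - E₁) * √(1 - E₂))
      = Real.cos (Real.arccos E₂ / 2 - Real.arccos E₁ / 2) := by
  rw [sqrt_one_add_eq hE₁, sqrt_one_add_eq hE₂, sqrt_one_sub_eq hE₁, sqrt_one_sub_eq hE₂,
    Real.cos_sub]
  have h : √2 * √2 = (2 : ℝ) := Real.mul_self_sqrt (by norm_num)
  linear_combination (1 / 2) * (Real.cos (Real.arccos E₂ / 2) * Real.cos (Real.arccos E₁ / 2)
    + Real.sin (Real.arccos E₂ / 2) * Real.sin (Real.arccos E₁ / 2)) * h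

/-- Every correlation `(E₁, E₂) ∈ [-1,1]²` satisfying the overlap
inequality `g(E₁,E₂) ≥ cos (J·α)` (for `0 < J·α < π/2`) is realised by a quantum
model of spin at most `J`: a unit vector `φ`, a measurement operator `0 ≤ M ≤ I`,
and a diagonal rotation unitary with spin labels bounded by `J`. -/
theorem overlap_inequality_realised_by_quantum_model
    (J α : ℝ) (hJ : 0 < J) (h1 : 0 < J * α) (h2 : J * α < Real.pi / 2)
    (E₁ E₂ : ℝ) (hE₁ : E₁ ∈ Set.Icc (-1 : ℝ) 1) (hE₂ : E₂ ∈ Set.Icc (-1 : ℝ) 1)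
    (hg : (1 / 2) * (Real.sqrt (1 + E₁) * Real.sqrt (1 + E₂)
      + Real.sqrt (1 - E₁) * Real.sqrt (1 - E₂)) ≥ Real.cos (J * α)) :
    ∃ (d : ℕ) (j : Fin d → ℝ) (φ : Fin d → ℂ) (M : Matrix (Fin d) (Fin d) ℂ),
      (∀ k, |j k| ≤ J) ∧
      star φ ⬝ᵥ φ = 1 ∧
      M.PosSemidef ∧ (1 - M).PosSemidef ∧
      2 * (star φ ⬝ᵥ M.mulVec φ) - 1 = (E₁ : ℂ) ∧
      2 * (star ((Matrix.diagonal fun k => Complex.exp (Complex.I * (j k * α))).mulVec φ) ⬝ᵥ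
            M.mulVec ((Matrix.diagonal fun k => Complex.exp (Complex.I * (j k * α))).mulVec φ))
        - 1 = (E₂ : ℂ) := by
  have hα : 0 < α := pos_of_mul_pos_right h1 hJ.le
  rw [overlap_eq_cos hE₁ hE₂] at hg
  set a := Real.arccos E₁ / 2 with ha
  set b := Real.arccos E₂ / 2 with hb
  have hab : |b - a| ≤ J * α := by
    by_contra! hlt
    have hle : |b - a| ≤ Real.pi := by
      rw [abs_le]
      constructor <;> linarith [Real.arccos_nonneg E₁, Real.arccos_nonneg E₂,
        Real.arccos_le_pi E₁, Real.arccos_le_pi E₂]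
    have := Real.cos_lt_cos_of_nonneg_of_le_pi h1.le hle hlt
    rw [Real.cos_abs] at this
    linarith
  have hs : |(b - a) / α| ≤ J := by
    rwa [abs_div, abs_of_pos hα, div_le_iff₀ hα]
  refine ⟨2, ![(b - a) / α, -((b - a) / α)], phaseVector a, plusProjection, ?_,
    phaseVector_norm a, plusProjection_posSemidef, one_sub_plusProjection_posSemidef, ?_, ?_⟩
  · intro k
    fin_cases k
    · simpa using hs
    · simpa only [Fin.mk_one, cons_val_one, cons_val_zero, abs_neg] using hs
  · rw [phaseVector_expectation, ha, mul_div_cancel₀ _ two_ne_zero, Real.cos_arccos hE₁.1 hE₁.2]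
  · rw [diagonal_mulVec_phaseVector, div_mul_cancel₀ _ hα.ne', add_sub_cancel,
      phaseVector_expectation, hb, mul_div_cancel₀ _ two_ne_zero, Real.cos_arccos hE₂.1 hE₂.2]
end

section
/- Let c₀, c₁, s₁ be real numbers and define P(α) := c₀ + c₁·cos(α) + s₁·sin(α). Then 0 ≤ P(α) ≤ 1 holds for all α ∈ ℝ if and only if 0 ≤ c₀ ≤ 1 and c₁² + s₁² ≤ (min(c₀, 1−c₀))². -/
open Real

/-- A vector of the plane in polar coordinates. -/
lemma exists_polar_coordinates (a b : ℝ) :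
    ∃ r θ : ℝ, 0 ≤ r ∧ a = r * Real.cos θ ∧ b = r * Real.sin θ :=
  ⟨‖(⟨a, b⟩ : ℂ)‖, Complex.arg ⟨a, b⟩, norm_nonneg _,
    (Complex.norm_mul_cos_arg ⟨a, b⟩).symm, (Complex.norm_mul_sin_arg ⟨a, b⟩).symm⟩

/-- The linear combination `a cos α + b sin α` is bounded by `m` in absolute value
if `a² + b² ≤ m²`. -/
lemma abs_mul_cos_add_mul_sin_le {a b m : ℝ} (hm : 0 ≤ m) (h : a ^ 2 + b ^ 2 ≤ m ^ 2) (α : ℝ) :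
    |a * Real.cos α + b * Real.sin α| ≤ m := by
  refine abs_le_of_sq_le_sq (le_trans ?_ h) hm
  linear_combination sq_nonneg (a * Real.sin α - b * Real.cos α) +
    (a ^ 2 + b ^ 2) * Real.sin_sq_add_cos_sq α

/-- The function `P(α) = c₀ + c₁·cos α + s₁·sin α` takes values in
`[0,1]` for all `α` if and only if `0 ≤ c₀ ≤ 1` and `c₁² + s₁² ≤ (min c₀ (1-c₀))²`.
This characterises the set `R_{1/2}` of spin-1/2 rotation boxes. -/
theorem spin_half_rotation_box_characterisation (c₀ c₁ s₁ : ℝ) :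
    (∀ α : ℝ, 0 ≤ c₀ + c₁ * Real.cos α + s₁ * Real.sin α ∧
        c₀ + c₁ * Real.cos α + s₁ * Real.sin α ≤ 1) ↔
      (0 ≤ c₀ ∧ c₀ ≤ 1 ∧ c₁ ^ 2 + s₁ ^ 2 ≤ (min c₀ (1 - c₀)) ^ 2) := by
  constructor
  · intro h
    obtain ⟨r, θ, hr, rfl, rfl⟩ := exists_polar_coordinates c₁ s₁
    have hθ := Real.sin_sq_add_cos_sq θ
    have hmax : c₀ + r ≤ 1 := by linear_combination (h θ).2 - r * hθ
    have hmin : 0 ≤ c₀ - r := by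
      have hπ := (h (θ + π)).1
      rw [Real.cos_add_pi, Real.sin_add_pi] at hπ
      linear_combination hπ - r * hθ
    refine ⟨by linarith, by linarith, ?_⟩
    calc (r * Real.cos θ) ^ 2 + (r * Real.sin θ) ^ 2 = r ^ 2 := by
          linear_combination r ^ 2 * hθ
      _ ≤ (min c₀ (1 - c₀)) ^ 2 :=
          pow_le_pow_left₀ hr (le_min (by linarith) (by linarith)) 2
  · rintro ⟨h0, h1, h⟩ α
    have hα := abs_le.mp (abs_mul_cos_add_mul_sin_le (le_min h0 (sub_nonneg.mpr h1)) h α)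
    have hl := min_le_left c₀ (1 - c₀)
    have hr := min_le_right c₀ (1 - c₀)
    constructor <;> linarith [hα.1, hα.2]
end

section
/- Let A := {(x,y,z) ∈ ℝ³ : 0 ≤ x ≤ 1 and y² + z² ≤ (min(x, 1−x))²}. Then the set of extreme points of A is exactly {(0,0,0), (1,0,0)} ∪ {(1/2, y, z) : y² + z² = 1/4}. -/
/-- The parameter region of spin-1/2 rotation boxes, as a subset of `ℝ³`. -/
def spinHalfBody : Set (ℝ × ℝ × ℝ) :=
  {p | 0 ≤ p.1 ∧ p.1 ≤ 1 ∧ p.2.1 ^ 2 + p.2.2 ^ 2 ≤ (min p.1 (1 - p.1)) ^ 2}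

/-- The condition involving the minimum splits into two cone conditions. -/
theorem mem_spinHalfBody_iff {x y z : ℝ} :
    (x, y, z) ∈ spinHalfBody ↔
      0 ≤ x ∧ x ≤ 1 ∧ y ^ 2 + z ^ 2 ≤ x ^ 2 ∧ y ^ 2 + z ^ 2 ≤ (1 - x) ^ 2 := by
  simp only [spinHalfBody, Set.mem_ofPred_eq]
  refine and_congr_right fun h0 => and_congr_right fun h1 => ?_
  rcases le_total x (1 - x) with h | h
  · rw [min_eq_left h]
    exact ⟨fun hr => ⟨hr, by nlinarith⟩, And.left⟩
  · rw [min_eq_right h]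
    exact ⟨fun hr => ⟨by nlinarith, hr⟩, And.right⟩

/-- The reflection `x ↦ 1 - x` preserves the body. -/
theorem one_sub_mem_spinHalfBody_iff {x y z : ℝ} :
    (1 - x, y, z) ∈ spinHalfBody ↔ (x, y, z) ∈ spinHalfBody := by
  simp only [mem_spinHalfBody_iff, sub_sub_cancel]
  constructor <;> rintro ⟨h0, h1, h2, h3⟩ <;> exact ⟨by linarith, by linarith, h3, h2⟩

theorem zero_mem_spinHalfBody : ((0 : ℝ), (0 : ℝ), (0 : ℝ)) ∈ spinHalfBody := by
  simp [mem_spinHalfBody_iff]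

theorem one_mem_spinHalfBody : ((1 : ℝ), (0 : ℝ), (0 : ℝ)) ∈ spinHalfBody := by
  simp [mem_spinHalfBody_iff]

theorem half_mem_spinHalfBody_iff {y z : ℝ} :
    (1 / 2, y, z) ∈ spinHalfBody ↔ y ^ 2 + z ^ 2 ≤ 1 / 4 := by
  rw [mem_spinHalfBody_iff]
  norm_num

/-- The radial projection of a point of the lower cone to the equatorial disc. -/
theorem half_div_mem_spinHalfBody {x y z : ℝ} (hx : 0 < x) (h : y ^ 2 + z ^ 2 ≤ x ^ 2) :
    (1 / 2, y / (2 * x), z / (2 * x)) ∈ spinHalfBody := by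
  rw [half_mem_spinHalfBody_iff, div_pow, div_pow, ← add_div, div_le_iff₀ (by positivity)]
  linarith

theorem sq_add_sq_le_of_mem_spinHalfBody {x y z : ℝ} (h : (x, y, z) ∈ spinHalfBody) :
    y ^ 2 + z ^ 2 ≤ 1 / 4 := by
  obtain ⟨h0, h1, h2, h3⟩ := mem_spinHalfBody_iff.1 h
  rcases le_total x (1 / 2) with hx | hx <;> nlinarith

theorem eq_half_of_mem_spinHalfBody {x y z : ℝ} (h : (x, y, z) ∈ spinHalfBody)
    (hr : y ^ 2 + z ^ 2 = 1 / 4) : x = 1 / 2 := by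
  obtain ⟨h0, h1, h2, h3⟩ := mem_spinHalfBody_iff.1 h
  apply le_antisymm <;> nlinarith

theorem eq_zero_of_mem_spinHalfBody {y z : ℝ} (h : (0, y, z) ∈ spinHalfBody) :
    y = 0 ∧ z = 0 := by
  obtain ⟨-, -, h2, -⟩ := mem_spinHalfBody_iff.1 h
  constructor <;> nlinarith [sq_nonneg y, sq_nonneg z]

theorem eq_zero_of_one_mem_spinHalfBody {y z : ℝ} (h : (1, y, z) ∈ spinHalfBody) :
    y = 0 ∧ z = 0 :=
  eq_zero_of_mem_spinHalfBody (by simpa using one_sub_mem_spinHalfBody_iff.2 h)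

theorem zero_mem_extremePoints_spinHalfBody :
    ((0 : ℝ), (0 : ℝ), (0 : ℝ)) ∈ Set.extremePoints ℝ spinHalfBody := by
  refine ⟨zero_mem_spinHalfBody, ?_⟩
  rintro ⟨x₁, y₁, z₁⟩ h₁ ⟨x₂, y₂, z₂⟩ h₂ ⟨a, b, ha, hb, -, h⟩
  simp only [Prod.smul_mk, Prod.mk_add_mk, smul_eq_mul, Prod.mk.injEq] at h
  have hx₁ := (mem_spinHalfBody_iff.1 h₁).1
  have hx₂ := (mem_spinHalfBody_iff.1 h₂).1
  obtain rfl : x₁ = 0 := by nlinarith [mul_nonneg hb.le hx₂]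
  obtain ⟨rfl, rfl⟩ := eq_zero_of_mem_spinHalfBody h₁
  rfl

theorem one_mem_extremePoints_spinHalfBody :
    ((1 : ℝ), (0 : ℝ), (0 : ℝ)) ∈ Set.extremePoints ℝ spinHalfBody := by
  refine ⟨one_mem_spinHalfBody, ?_⟩
  rintro ⟨x₁, y₁, z₁⟩ h₁ ⟨x₂, y₂, z₂⟩ h₂ ⟨a, b, ha, hb, hab, h⟩
  simp only [Prod.smul_mk, Prod.mk_add_mk, smul_eq_mul, Prod.mk.injEq] at h
  have hx₁ := (mem_spinHalfBody_iff.1 h₁).2.1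
  have hx₂ := (mem_spinHalfBody_iff.1 h₂).2.1
  obtain rfl : x₁ = 1 := by nlinarith [mul_nonneg hb.le (sub_nonneg.2 hx₂)]
  obtain ⟨rfl, rfl⟩ := eq_zero_of_one_mem_spinHalfBody h₁
  rfl

theorem half_mem_extremePoints_spinHalfBody {y z : ℝ} (hr : y ^ 2 + z ^ 2 = 1 / 4) :
    (1 / 2, y, z) ∈ Set.extremePoints ℝ spinHalfBody := by
  refine ⟨half_mem_spinHalfBody_iff.2 hr.le, ?_⟩
  rintro ⟨x₁, y₁, z₁⟩ h₁ ⟨x₂, y₂, z₂⟩ h₂ ⟨a, b, ha, hb, hab, h⟩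
  simp only [Prod.smul_mk, Prod.mk_add_mk, smul_eq_mul, Prod.mk.injEq] at h
  obtain ⟨-, hy, hz⟩ := h
  have hr₁ := sq_add_sq_le_of_mem_spinHalfBody h₁
  have hr₂ := sq_add_sq_le_of_mem_spinHalfBody h₂
  obtain rfl : b = 1 - a := by linarith
  have hgap : a * (1 - a) * ((y₁ - y₂) ^ 2 + (z₁ - z₂) ^ 2) ≤ 0 := by
    have key : a * (1 - a) * ((y₁ - y₂) ^ 2 + (z₁ - z₂) ^ 2) =
        a * (y₁ ^ 2 + z₁ ^ 2) + (1 - a) * (y₂ ^ 2 + z₂ ^ 2) - (y ^ 2 + z ^ 2) := by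
      rw [← hy, ← hz]
      ring
    have := mul_le_mul_of_nonneg_left hr₁ ha.le
    have := mul_le_mul_of_nonneg_left hr₂ hb.le
    linarith
  have hdist : (y₁ - y₂) ^ 2 + (z₁ - z₂) ^ 2 ≤ 0 :=
    nonpos_of_mul_nonpos_right hgap (mul_pos ha hb)
  obtain rfl : y₁ = y₂ := by nlinarith [sq_nonneg (y₁ - y₂), sq_nonneg (z₁ - z₂)]
  obtain rfl : z₁ = z₂ := by nlinarith [sq_nonneg (z₁ - z₂)]
  obtain rfl : y₁ = y := by linarith
  obtain rfl : z₁ = z := by linarith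
  rw [eq_half_of_mem_spinHalfBody h₁ hr]

theorem not_mem_extremePoints_spinHalfBody_of_lt_half {x y z : ℝ} (h0 : 0 < x)
    (hx : x < 1 / 2) : (x, y, z) ∉ Set.extremePoints ℝ spinHalfBody := by
  intro h
  have hq := half_div_mem_spinHalfBody h0 (mem_spinHalfBody_iff.1 h.1).2.2.1
  have heq := h.2 zero_mem_spinHalfBody hq
    ⟨1 - 2 * x, 2 * x, by linarith, by linarith, by ring, by
      simp only [Prod.smul_mk, Prod.mk_add_mk, smul_eq_mul, Prod.mk.injEq]
      refine ⟨?_, ?_, ?_⟩ <;> field_simp <;> ring⟩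
  exact h0.ne (Prod.mk.inj heq).1

theorem not_mem_extremePoints_spinHalfBody_of_half_lt {x y z : ℝ} (hx : 1 / 2 < x)
    (h1 : x < 1) : (x, y, z) ∉ Set.extremePoints ℝ spinHalfBody := by
  intro h
  have h1' : 0 < 1 - x := sub_pos.2 h1
  have hq := half_div_mem_spinHalfBody h1' (mem_spinHalfBody_iff.1 h.1).2.2.2
  have heq := h.2 one_mem_spinHalfBody hq
    ⟨1 - 2 * (1 - x), 2 * (1 - x), by linarith, by linarith, by ring, by
      simp only [Prod.smul_mk, Prod.mk_add_mk, smul_eq_mul, Prod.mk.injEq]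
      refine ⟨?_, ?_, ?_⟩ <;> field_simp <;> ring⟩
  exact h1.ne' (Prod.mk.inj heq).1

/-- Points in the open equatorial disc are midpoints of short horizontal segments. -/
theorem half_not_mem_extremePoints_spinHalfBody {y z : ℝ} (hr : y ^ 2 + z ^ 2 < 1 / 4) :
    (1 / 2, y, z) ∉ Set.extremePoints ℝ spinHalfBody := by
  intro h
  obtain ⟨t, ht⟩ : ∃ t, t = (1 / 4 - (y ^ 2 + z ^ 2)) / 2 := ⟨_, rfl⟩
  have ht0 : 0 < t := by linarith
  have ht1 : t ≤ 1 := by nlinarith [sq_nonneg y, sq_nonneg z]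
  have htt : t * t ≤ t := mul_le_of_le_one_left ht0.le ht1
  obtain ⟨hy, hy'⟩ : -(1 / 2) ≤ y ∧ y ≤ 1 / 2 := by
    constructor <;> nlinarith [sq_nonneg z]
  have hp : (1 / 2, y + t, z) ∈ spinHalfBody := half_mem_spinHalfBody_iff.2 (by nlinarith)
  have hm : (1 / 2, y - t, z) ∈ spinHalfBody := half_mem_spinHalfBody_iff.2 (by nlinarith)
  have heq := h.2 hp hm
    ⟨1 / 2, 1 / 2, by norm_num, by norm_num, by norm_num, by
      simp only [Prod.smul_mk, Prod.mk_add_mk, smul_eq_mul, Prod.mk.injEq]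
      refine ⟨?_, ?_, ?_⟩ <;> ring⟩
  simp only [Prod.mk.injEq] at heq
  linarith [heq.2.1]

/-- The extreme points of the convex body
`A = {(x,y,z) : 0 ≤ x ≤ 1, y² + z² ≤ (min x (1-x))²}` (the parameter region of
spin-1/2 rotation boxes) are exactly `(0,0,0)`, `(1,0,0)`, and the circle
`{(1/2, y, z) : y² + z² = 1/4}`. -/
theorem extreme_points_of_spin_half_body :
    Set.extremePoints ℝ
        {p : ℝ × ℝ × ℝ | 0 ≤ p.1 ∧ p.1 ≤ 1 ∧
          p.2.1 ^ 2 + p.2.2 ^ 2 ≤ (min p.1 (1 - p.1)) ^ 2} =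
      ({((0 : ℝ), (0 : ℝ), (0 : ℝ)), ((1 : ℝ), (0 : ℝ), (0 : ℝ))} : Set (ℝ × ℝ × ℝ)) ∪
        {p : ℝ × ℝ × ℝ | p.1 = 1 / 2 ∧ p.2.1 ^ 2 + p.2.2 ^ 2 = 1 / 4} := by
  change Set.extremePoints ℝ spinHalfBody = _
  ext ⟨x, y, z⟩
  constructor
  · intro h
    obtain ⟨h0, h1, -⟩ := mem_spinHalfBody_iff.1 h.1
    rcases h0.eq_or_lt with rfl | h0
    · obtain ⟨rfl, rfl⟩ := eq_zero_of_mem_spinHalfBody h.1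
      simp
    rcases h1.eq_or_lt with rfl | h1
    · obtain ⟨rfl, rfl⟩ := eq_zero_of_one_mem_spinHalfBody h.1
      simp
    rcases lt_trichotomy x (1 / 2) with hx | rfl | hx
    · exact absurd h (not_mem_extremePoints_spinHalfBody_of_lt_half h0 hx)
    · refine Or.inr ⟨rfl, ?_⟩
      rcases (half_mem_spinHalfBody_iff.1 h.1).eq_or_lt with hr | hr
      · exact hr
      · exact absurd h (half_not_mem_extremePoints_spinHalfBody hr)
    · exact absurd h (not_mem_extremePoints_spinHalfBody_of_half_lt hx h1)
  · rintro ((h | h) | ⟨h, hr⟩)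
    · rw [h]
      exact zero_mem_extremePoints_spinHalfBody
    · rw [Set.mem_singleton_iff.1 h]
      exact one_mem_extremePoints_spinHalfBody
    · obtain rfl : x = 1 / 2 := h
      exact half_mem_extremePoints_spinHalfBody hr
end

section
/- Let c₀, c₁, s₁ be real numbers such that 0 ≤ c₀ + c₁·cos(α) + s₁·sin(α) ≤ 1 for all α ∈ ℝ. Then there exist d ∈ ℕ, a map j : Fin d → {1/2, −1/2}, a unit vector φ ∈ ℂ^d, and a complex d×d matrix M with both M and I−M positive semidefinite, such that for all α ∈ ℝ, ⟨U_α φ, M (U_α φ)⟩ = c₀ + c₁·cos(α) + s₁·sin(α), where U_α is the diagonal matrix with entries exp(i·j_k·α). (Every spin-1/2 rotation box is realised by a quantum model: R_{1/2} = Q_{1/2}.) -/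
open Real Matrix
open scoped ComplexOrder

/-- A Hermitian `2 × 2` matrix with constant diagonal `a` and off-diagonal entry `z` is positive
semidefinite as soon as `‖z‖ ≤ a`. -/
theorem posSemidef_of_norm_le {a : ℝ} {z : ℂ} (hz : ‖z‖ ≤ a) :
    (!![(a : ℂ), z; star z, (a : ℂ)]).PosSemidef := by
  set u : ℂ := Complex.exp (z.arg * Complex.I) with hu
  have hzu : (‖z‖ : ℂ) * u = z := Complex.norm_mul_exp_arg_mul_I z
  have huu : star u * u = 1 := by
    rw [Complex.star_def, Complex.conj_mul', hu, Complex.norm_exp_ofReal_mul_I]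
    simp
  have hzu' : (‖z‖ : ℂ) * star u = star z := by
    conv_rhs => rw [← hzu]
    simp
  have hdecomp : !![(a : ℂ), z; star z, (a : ℂ)] =
      ((a - ‖z‖ : ℝ) : ℂ) • (1 : Matrix (Fin 2) (Fin 2) ℂ) +
        ((‖z‖ : ℝ) : ℂ) • vecMulVec ![1, star u] (star ![1, star u]) := by
    ext i k
    rw [Matrix.add_apply, Matrix.smul_apply, Matrix.smul_apply, vecMulVec_apply]
    fin_cases i <;> fin_cases k <;> simp at hzu hzu' huu ⊢
    · exact hzu.symm
    · exact hzu'.symm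
    · rw [huu]; ring
  rw [hdecomp]
  refine (PosSemidef.one.smul ?_).add ((posSemidef_vecMulVec_self_star _).smul ?_)
  · exact Complex.zero_le_real.mpr (sub_nonneg.mpr hz)
  · exact Complex.zero_le_real.mpr (norm_nonneg z)

/-- The amplitude of a trigonometric polynomial of degree one with values in `[0, 1]` is bounded by
the distance of its mean to the endpoints. -/
theorem norm_le_of_trig_mem_Icc {c₀ c₁ s₁ : ℝ}
    (h : ∀ α : ℝ, 0 ≤ c₀ + c₁ * Real.cos α + s₁ * Real.sin α ∧
        c₀ + c₁ * Real.cos α + s₁ * Real.sin α ≤ 1) :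
    ‖(⟨c₁, s₁⟩ : ℂ)‖ ≤ c₀ ∧ ‖(⟨c₁, s₁⟩ : ℂ)‖ ≤ 1 - c₀ := by
  set z : ℂ := ⟨c₁, s₁⟩
  have hc : ‖z‖ * Real.cos z.arg = c₁ := Complex.norm_mul_cos_arg z
  have hs : ‖z‖ * Real.sin z.arg = s₁ := Complex.norm_mul_sin_arg z
  have hamp : c₁ * Real.cos z.arg + s₁ * Real.sin z.arg = ‖z‖ := by
    linear_combination (-Real.cos z.arg) * hc - Real.sin z.arg * hs +
      ‖z‖ * Real.sin_sq_add_cos_sq z.arg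
  have hmax := (h z.arg).2
  have hmin := (h (z.arg + π)).1
  rw [Real.cos_add_pi, Real.sin_add_pi] at hmin
  constructor <;> linarith

/-- Every spin-1/2 rotation box is realised by a quantum model
(`R_{1/2} = Q_{1/2}`): if `P(α) = c₀ + c₁·cos α + s₁·sin α ∈ [0,1]` for all `α`,
then there is a quantum model with spin labels `±1/2`, a unit vector `φ` and a
measurement operator `0 ≤ M ≤ I` reproducing `P(α)` for every angle `α`. -/
theorem spin_half_rotation_box_has_quantum_model (c₀ c₁ s₁ : ℝ)
    (h : ∀ α : ℝ, 0 ≤ c₀ + c₁ * Real.cos α + s₁ * Real.sin α ∧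
        c₀ + c₁ * Real.cos α + s₁ * Real.sin α ≤ 1) :
    ∃ (d : ℕ) (j : Fin d → ℝ) (φ : Fin d → ℂ) (M : Matrix (Fin d) (Fin d) ℂ),
      (∀ k, j k = 1 / 2 ∨ j k = -(1 / 2)) ∧
      star φ ⬝ᵥ φ = 1 ∧
      M.PosSemidef ∧ (1 - M).PosSemidef ∧
      ∀ α : ℝ,
        star ((Matrix.diagonal fun k => Complex.exp (Complex.I * (j k * α))).mulVec φ) ⬝ᵥ
            M.mulVec ((Matrix.diagonal fun k => Complex.exp (Complex.I * (j k * α))).mulVec φ)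
          = ((c₀ + c₁ * Real.cos α + s₁ * Real.sin α : ℝ) : ℂ) := by
  obtain ⟨h₀, h₁⟩ := norm_le_of_trig_mem_Icc h
  set z : ℂ := ⟨c₁, s₁⟩
  have hsqrt : ((√2 : ℝ) : ℂ)⁻¹ * ((√2 : ℝ) : ℂ)⁻¹ = 1 / 2 := by
    rw [← mul_inv, ← Complex.ofReal_mul, Real.mul_self_sqrt zero_le_two]
    norm_num
  refine ⟨2, ![1 / 2, -(1 / 2)], fun _ => ((√2 : ℝ) : ℂ)⁻¹,
    !![(c₀ : ℂ), z; star z, (c₀ : ℂ)], ?_, ?_, posSemidef_of_norm_le h₀, ?_, fun α => ?_⟩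
  · intro k
    fin_cases k <;> simp
  · simp only [dotProduct, Fin.sum_univ_two, Pi.star_apply, star_inv₀, Complex.star_def,
      Complex.conj_ofReal, hsqrt]
    norm_num
  · have hcompl : 1 - !![(c₀ : ℂ), z; star z, (c₀ : ℂ)] =
        !![((1 - c₀ : ℝ) : ℂ), -z; star (-z), ((1 - c₀ : ℝ) : ℂ)] := by
      ext i k
      fin_cases i <;> fin_cases k <;> simp
    rw [hcompl]
    exact posSemidef_of_norm_le (by rwa [norm_neg])
  · have hz' : z = c₁ + s₁ * Complex.I := Complex.mk_eq_add_mul_I c₁ s₁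
    set c : ℝ := Real.cos (α / 2) with hc
    set s : ℝ := Real.sin (α / 2) with hs
    set q : ℂ := ((√2 : ℝ) : ℂ)⁻¹ with hq
    have hstate : (Matrix.diagonal fun k => Complex.exp
        (Complex.I * ((![1 / 2, -(1 / 2)] : Fin 2 → ℝ) k * α))).mulVec (fun _ => q) =
        ![(c + s * Complex.I) * q, (c + -s * Complex.I) * q] := by
      ext k
      rw [mulVec_diagonal]
      fin_cases k
      · have hpos : Complex.I * (((1 / 2 : ℝ) : ℂ) * α) = ((α / 2 : ℝ) : ℂ) * Complex.I := by
          push_cast; ring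
        simp only [Fin.zero_eta, cons_val_zero]
        rw [hpos, Complex.exp_mul_I, hc, hs, Complex.ofReal_cos, Complex.ofReal_sin]
      · have hneg : Complex.I * (((-(1 / 2) : ℝ) : ℂ) * α) = -((α / 2 : ℝ) : ℂ) * Complex.I := by
          push_cast; ring
        simp only [Fin.mk_one, cons_val_one, cons_val_zero]
        rw [hneg, Complex.exp_mul_I, Complex.cos_neg, Complex.sin_neg, hc, hs,
          Complex.ofReal_cos, Complex.ofReal_sin]
    have hcos : Real.cos α = 2 * c ^ 2 - 1 := by
      rw [hc, ← Real.cos_two_mul]; congr 1; ring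
    have hsin : Real.sin α = 2 * s * c := by
      rw [hc, hs, ← Real.sin_two_mul]; congr 1; ring
    have hsc : (s : ℂ) ^ 2 + (c : ℂ) ^ 2 = 1 := by
      exact_mod_cast Real.sin_sq_add_cos_sq (α / 2)
    have hI : star Complex.I = -Complex.I := Complex.conj_I
    have hreal (x : ℝ) : star (x : ℂ) = x := Complex.conj_ofReal x
    have hqr : star q = q := by rw [hq, star_inv₀, hreal]
    rw [hstate, hcos, hsin]
    simp only [dotProduct, mulVec, Fin.sum_univ_two, Pi.star_apply, of_apply,
      cons_val_zero, cons_val_one, hz', star_mul', star_add, star_neg, hqr, hI, hreal]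
    push_cast
    linear_combination
      (2 * c₀ * (c ^ 2 - s ^ 2 * Complex.I ^ 2) + 2 * c₁ * (c ^ 2 + s ^ 2 * Complex.I ^ 2) -
        4 * s₁ * c * s * Complex.I ^ 2) * hsqrt +
      (-c₀ * s ^ 2 + c₁ * s ^ 2 - 2 * s₁ * c * s) * Complex.I_sq + (c₀ - c₁) * hsc
end

section
/- Let 0 ≤ ε ≤ 1 and let Δ := {(E,E) : E ∈ [−1,1]} ⊆ ℝ². Then {(1−ε)·e + ε·e′ : e ∈ Δ, e′ ∈ [−1,1]²} = {(E₁,E₂) ∈ [−1,1]² : |E₁ − E₂| ≤ 2ε}. (The ε-relaxed classical set is exactly characterised by the inequality |E₁ − E₂| ≤ 2ε.) -/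
open Real

/-- A real number of absolute value at most `c` is `c` times a point of `[-1, 1]`. -/
theorem exists_mem_Icc_eq_mul_of_abs_le {t c : ℝ} (h : |t| ≤ c) :
    ∃ x ∈ Set.Icc (-1 : ℝ) 1, t = c * x := by
  rcases ((abs_nonneg t).trans h).eq_or_lt with rfl | hc
  · exact ⟨0, by norm_num, by simpa using h⟩
  · refine ⟨t / c, ?_, by field_simp⟩
    rw [Set.mem_Icc, ← abs_le, abs_div, abs_of_pos hc]
    exact (div_le_one hc).2 h

/-- The `ε`-relaxed classical set (relaxation of the diagonal
`Δ = {(E,E) : E ∈ [-1,1]}`) is exactly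
`{(E₁,E₂) ∈ [-1,1]² : |E₁ - E₂| ≤ 2ε}`. -/
theorem relaxed_classical_set_characterisation (ε : ℝ) (hε0 : 0 ≤ ε) (hε1 : ε ≤ 1) :
    {q : ℝ × ℝ | ∃ e ∈ {x : ℝ × ℝ | ∃ E ∈ Set.Icc (-1 : ℝ) 1, x = (E, E)},
        ∃ e' ∈ Set.Icc ((-1, -1) : ℝ × ℝ) ((1, 1) : ℝ × ℝ),
          q = (1 - ε) • e + ε • e'} =
      {E : ℝ × ℝ | E ∈ Set.Icc ((-1, -1) : ℝ × ℝ) ((1, 1) : ℝ × ℝ) ∧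
        |E.1 - E.2| ≤ 2 * ε} := by
  ext ⟨a, b⟩
  simp only [Set.mem_ofPred_eq, Set.mem_Icc, Prod.mk_le_mk]
  constructor
  · rintro ⟨_, ⟨E, ⟨hE, hE'⟩, rfl⟩, ⟨x, y⟩, ⟨⟨hx, hy⟩, hx', hy'⟩, h⟩
    simp only [Prod.smul_mk, Prod.mk_add_mk, smul_eq_mul, Prod.mk.injEq] at h
    obtain ⟨rfl, rfl⟩ := h
    refine ⟨⟨⟨?_, ?_⟩, ?_, ?_⟩, abs_le.2 ⟨?_, ?_⟩⟩ <;> nlinarith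
  · rintro ⟨⟨⟨ha, hb⟩, ha', hb'⟩, h⟩
    obtain ⟨h₁, h₂⟩ := abs_le.1 h
    obtain ⟨t, ht, hta, htb⟩ : ∃ t : ℝ, |t| ≤ 1 - ε ∧ |a - t| ≤ ε ∧ |b - t| ≤ ε := by
      refine ⟨max (max a b - ε) (-(1 - ε)), ?_⟩
      simp only [abs_le]
      grind
    obtain ⟨E, hE, rfl⟩ := exists_mem_Icc_eq_mul_of_abs_le ht
    obtain ⟨x, hx, hax⟩ := exists_mem_Icc_eq_mul_of_abs_le hta
    obtain ⟨y, hy, hby⟩ := exists_mem_Icc_eq_mul_of_abs_le htb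
    refine ⟨(E, E), ⟨E, hE, rfl⟩, (x, y), ⟨⟨hx.1, hy.1⟩, hx.2, hy.2⟩, ?_⟩
    simp only [Prod.smul_mk, Prod.mk_add_mk, smul_eq_mul, Prod.mk.injEq]
    constructor <;> linarith
end
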